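/- arXiv:2012.04560 — 2 statements merged into one kernel-verified Lean document; each statement's English description precedes it below -/
import Mathlib

section
/- The P_5-chromatic number of the Cartesian product C_3 □ C_4 equals 4: s_5(C_3 □ C_4) = 4. -/
open SimpleGraph

/-- `f` is a `P_k`-coloring of `G`: a proper vertex coloring such that no path on `k`
vertices is bicolored, i.e. every path on `k` vertices receives at least 3 distinct colors. -/
def IsPkColoring {V α : Type*} [DecidableEq α] (G : SimpleGraph V) (k : ℕ) (f : V → α) : Prop :=
  (∀ u w : V, G.Adj u w → f u ≠ f w) ∧
  ∀ (u w : V) (p : G.Walk u w), p.IsPath → p.length + 1 = k →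
    3 ≤ (p.support.map f).toFinset.card

/-- The `P_k`-chromatic number: the least number of colors of a `P_k`-coloring. -/
noncomputable def pkChrom {V : Type*} (G : SimpleGraph V) (k : ℕ) : ℕ :=
  sInf {n : ℕ | ∃ f : V → Fin n, IsPkColoring G k f}

instance {V W : Type*} [DecidableEq V] [DecidableEq W] (G : SimpleGraph V) (H : SimpleGraph W)
    [DecidableRel G.Adj] [DecidableRel H.Adj] : DecidableRel (G.boxProd H).Adj :=
  fun _ _ => decidable_of_iff' _ boxProd_adj

theorem isPkColoring_five_iff {V α : Type*} [DecidableEq α] (G : SimpleGraph V) (f : V → α) :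
    IsPkColoring G 5 f ↔ (∀ u w, G.Adj u w → f u ≠ f w) ∧
      ∀ a b, G.Adj a b → ∀ c, G.Adj b c → ∀ d, G.Adj c d → ∀ e, G.Adj d e →
        [a, b, c, d, e].Nodup → 3 ≤ ([a, b, c, d, e].map f).toFinset.card := by
  refine and_congr_right fun _ => ⟨?_, ?_⟩
  · intro h a b hab c hbc d hcd e hde hn
    exact h a e (.cons hab (.cons hbc (.cons hcd (.cons hde .nil)))) (Walk.IsPath.mk' hn) rfl
  · intro h u w p hp hl
    match p, hp, hl with
    | .cons hab (.cons hbc (.cons hcd (.cons hde .nil))), hp, _ =>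
      exact h _ _ hab _ hbc _ hcd _ hde hp.support_nodup

theorem IsPkColoring.comp_injective {V α β : Type*} [DecidableEq α] [DecidableEq β]
    {G : SimpleGraph V} {k : ℕ} {f : V → α} (hf : IsPkColoring G k f) {g : α → β}
    (hg : g.Injective) : IsPkColoring G k (g ∘ f) := by
  refine ⟨fun u w h => hg.ne (hf.1 u w h), fun u w p hp hl => ?_⟩
  have himage : (p.support.map (g ∘ f)).toFinset = (p.support.map f).toFinset.image g := by
    ext; simp
  rw [himage, Finset.card_image_of_injective _ hg]
  exact hf.2 u w p hp hl

set_option synthInstance.maxSize 2000 in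
set_option synthInstance.maxHeartbeats 400000 in
/-- The columns `x`, `y`, `z`, `t` are the color triples on the successive triangles. -/
theorem exists_bicolored_path :
    ∀ x₀ x₁ : Fin 3, x₀ ≠ x₁ → ∀ x₂, x₀ ≠ x₂ → x₁ ≠ x₂ →
    ∀ y₀, x₀ ≠ y₀ → ∀ y₁, x₁ ≠ y₁ → y₀ ≠ y₁ → ∀ y₂, x₂ ≠ y₂ → y₀ ≠ y₂ → y₁ ≠ y₂ →
    ∀ z₀, y₀ ≠ z₀ → ∀ z₁, y₁ ≠ z₁ → z₀ ≠ z₁ → ∀ z₂, y₂ ≠ z₂ → z₀ ≠ z₂ → z₁ ≠ z₂ →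
    ∀ t₁, z₁ ≠ t₁ → x₁ ≠ t₁ →
    3 ≤ [x₀, x₁, y₁, z₁, z₀].toFinset.card → 3 ≤ [x₀, x₂, y₂, z₂, z₀].toFinset.card →
    3 ≤ [x₀, y₀, y₁, z₁, t₁].toFinset.card → 3 ≤ [x₀, y₀, y₂, z₂, z₁].toFinset.card →
    False := by
  decide +kernel

theorem not_isPkColoring_fin_three (f : Fin 3 × Fin 4 → Fin 3) :
    ¬ IsPkColoring ((cycleGraph 3).boxProd (cycleGraph 4)) 5 f := by
  rw [isPkColoring_five_iff]
  rintro ⟨hp, h⟩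
  apply exists_bicolored_path (f (0, 0)) (f (1, 0)) _ (f (2, 0)) _ _
    (f (0, 1)) _ (f (1, 1)) _ _ (f (2, 1)) _ _ _
    (f (0, 2)) _ (f (1, 2)) _ _ (f (2, 2)) _ _ _ (f (1, 3))
  all_goals first
    | exact hp _ _ (by decide)
    | exact h (0, 0) (1, 0) (by decide) (1, 1) (by decide) (1, 2) (by decide) (0, 2) (by decide)
        (by decide)
    | exact h (0, 0) (2, 0) (by decide) (2, 1) (by decide) (2, 2) (by decide) (0, 2) (by decide)
        (by decide)
    | exact h (0, 0) (0, 1) (by decide) (1, 1) (by decide) (1, 2) (by decide) (1, 3) (by decide)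
        (by decide)
    | exact h (0, 0) (0, 1) (by decide) (2, 1) (by decide) (2, 2) (by decide) (1, 2) (by decide)
        (by decide)

/-- The coloring `(i, j) ↦ i xor j`. -/
def xorColoring (v : Fin 3 × Fin 4) : Fin 4 :=
  ![![0, 1, 2, 3], ![1, 0, 3, 2], ![2, 3, 0, 1]] v.1 v.2

set_option synthInstance.maxSize 2000 in
set_option synthInstance.maxHeartbeats 400000 in
theorem isPkColoring_xorColoring :
    IsPkColoring ((cycleGraph 3).boxProd (cycleGraph 4)) 5 xorColoring := by
  rw [isPkColoring_five_iff]
  decide +kernel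

theorem s5_C3_boxProd_C4 :
    pkChrom ((cycleGraph 3).boxProd (cycleGraph 4)) 5 = 4 := by
  refine IsLeast.csInf_eq ⟨⟨_, isPkColoring_xorColoring⟩, fun n ⟨f, hf⟩ => ?_⟩
  by_contra! hn
  exact not_isPkColoring_fin_three _
    (hf.comp_injective (Fin.castLE_injective (Nat.le_of_lt_succ hn)))
end

section
/- For all integers p, q ≥ 3 with p ≠ 5 and q ≠ 5, the P_5-chromatic number of the Cartesian product of cycles satisfies s_5(C_p □ C_q) = 4. -/
open SimpleGraph

/-- The colors of five consecutive vertices alternate between two values. -/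
def Alternates {α : Type*} (a b c d e : α) : Prop := a = c ∧ c = e ∧ b = d

instance {α : Type*} [DecidableEq α] (a b c d e : α) : Decidable (Alternates a b c d e) :=
  inferInstanceAs (Decidable (_ ∧ _))

section FiveVertexPaths

variable {V α : Type*} [DecidableEq α] {G : SimpleGraph V} {f : V → α}

theorem IsPkColoring.not_alternates (h : IsPkColoring G 5 f) {a b c d e : V}
    (hab : G.Adj a b) (hbc : G.Adj b c) (hcd : G.Adj c d) (hde : G.Adj d e)
    (hn : [a, b, c, d, e].Nodup) : ¬ Alternates (f a) (f b) (f c) (f d) (f e) := by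
  rintro ⟨h1, h2, h3⟩
  have hcard : 3 ≤ [f a, f b, f c, f d, f e].toFinset.card :=
    h.2 a e (.cons hab (.cons hbc (.cons hcd (.cons hde .nil))))
      (by rw [Walk.isPath_def]; simpa using hn) (by simp)
  have hsub : [f a, f b, f c, f d, f e].toFinset ⊆ {f b, f e} := by
    intro x
    simp only [h1, h2, h3, List.mem_toFinset, List.mem_cons, List.not_mem_nil, or_false,
      Finset.mem_insert, Finset.mem_singleton]
    tauto
  have := (Finset.card_le_card hsub).trans Finset.card_le_two
  omega

theorem isPkColoring_five_of_not_alternates (hproper : ∀ u w : V, G.Adj u w → f u ≠ f w)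
    (h : ∀ a b c d e : V, G.Adj a b → G.Adj b c → G.Adj c d → G.Adj d e →
      a ≠ c → b ≠ d → c ≠ e → a ≠ e → ¬ Alternates (f a) (f b) (f c) (f d) (f e)) :
    IsPkColoring G 5 f := by
  refine ⟨hproper, fun u w p hp hlen => ?_⟩
  rcases p with _ | ⟨hab, _ | ⟨hbc, _ | ⟨hcd, _ | ⟨hde, _ | ⟨_, _⟩⟩⟩⟩⟩ <;>
    simp only [Walk.length_cons, Walk.length_nil] at hlen <;> try omega
  rename_i b c d
  rw [Walk.isPath_def] at hp
  simp only [Walk.support_cons, Walk.support_nil, List.nodup_cons, List.mem_cons,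
    List.not_mem_nil, or_false, not_or] at hp
  have key := h u b c d w hab hbc hcd hde hp.1.2.1 hp.2.1.2.1 hp.2.2.1.2 hp.1.2.2.2
  have h1 := hproper _ _ hab
  have h2 := hproper _ _ hbc
  have h3 := hproper _ _ hcd
  have h4 := hproper _ _ hde
  refine Finset.two_lt_card.2 ?_
  simp only [Walk.support_cons, Walk.support_nil, List.map_cons, List.map_nil, List.mem_toFinset]
  by_cases hac : f u = f c
  · by_cases hbd : f b = f d
    · exact ⟨f c, by simp, f d, by simp, f w, by simp, h3, fun hce => key ⟨hac, hce, hbd⟩, h4⟩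
    · exact ⟨f b, by simp, f c, by simp, f d, by simp, h2, hbd, h3⟩
  · exact ⟨f u, by simp, f b, by simp, f c, by simp, h1, hac, h2⟩

end FiveVertexPaths

theorem three_by_three_grid_alternates : ∀ a b : Fin 3, a ≠ b → ∀ c, b ≠ c → ∀ d, a ≠ d →
    ∀ e, b ≠ e → d ≠ e → ∀ f, c ≠ f → e ≠ f → ∀ g, d ≠ g → ∀ h, e ≠ h → g ≠ h →
    ∀ i, f ≠ i → h ≠ i →
    Alternates c f e h g ∨ Alternates c b e h i ∨ Alternates a b e f i ∨ Alternates g d e f i ∨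
    Alternates d g h i f ∨ Alternates d e f i h ∨ Alternates b c f i h := by
  decide +kernel

theorem cycleGraph_adj_of_val_succ {p i j : ℕ} (hi : i < p) (hj : j < p) (hij : j = i + 1) :
    (cycleGraph p).Adj ⟨i, hi⟩ ⟨j, hj⟩ := by
  subst hij
  exact (pathGraph_le_cycleGraph : pathGraph p ≤ _) (pathGraph_adj.2 (Or.inl rfl))

theorem four_le_of_isPkColoring_five {p q n : ℕ} (hp : 3 ≤ p) (hq : 3 ≤ q)
    {f : Fin p × Fin q → Fin n}
    (hf : IsPkColoring ((cycleGraph p).boxProd (cycleGraph q)) 5 f) : 4 ≤ n := by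
  by_contra! hn
  let v (i j : Fin 3) : Fin p × Fin q := (i.castLE hp, j.castLE hq)
  let g (i j : Fin 3) : Fin 3 := (f (v i j)).castLE (by omega)
  have hv {i j k l : Fin 3} : v i j = v k l ↔ i = k ∧ j = l := by simp [v]
  have h01 (i : Fin 3) : ((cycleGraph p).boxProd (cycleGraph q)).Adj (v 0 i) (v 1 i) :=
    boxProd_adj.2 (.inl ⟨cycleGraph_adj_of_val_succ _ _ rfl, rfl⟩)
  have h12 (i : Fin 3) : ((cycleGraph p).boxProd (cycleGraph q)).Adj (v 1 i) (v 2 i) :=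
    boxProd_adj.2 (.inl ⟨cycleGraph_adj_of_val_succ _ _ rfl, rfl⟩)
  have k01 (i : Fin 3) : ((cycleGraph p).boxProd (cycleGraph q)).Adj (v i 0) (v i 1) :=
    boxProd_adj.2 (.inr ⟨cycleGraph_adj_of_val_succ _ _ rfl, rfl⟩)
  have k12 (i : Fin 3) : ((cycleGraph p).boxProd (cycleGraph q)).Adj (v i 1) (v i 2) :=
    boxProd_adj.2 (.inr ⟨cycleGraph_adj_of_val_succ _ _ rfl, rfl⟩)
  have hg {i j k l : Fin 3} (h : ((cycleGraph p).boxProd (cycleGraph q)).Adj (v i j) (v k l)) :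
      g i j ≠ g k l := fun e => hf.1 _ _ h (Fin.castLE_injective _ e)
  have hinj {i j k l : Fin 3} : g i j = g k l ↔ f (v i j) = f (v k l) :=
    (Fin.castLE_injective _).eq_iff
  have := three_by_three_grid_alternates (g 0 0) (g 0 1) (hg (k01 0)) (g 0 2) (hg (k12 0))
    (g 1 0) (hg (h01 0)) (g 1 1) (hg (h01 1)) (hg (k01 1)) (g 1 2) (hg (h01 2)) (hg (k12 1))
    (g 2 0) (hg (h12 0)) (g 2 1) (hg (h12 1)) (hg (k01 2)) (g 2 2) (hg (h12 2)) (hg (k12 2))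
  simp only [Alternates, hinj] at this
  rcases this with h | h | h | h | h | h | h
  · exact hf.not_alternates (h01 2) (k12 1).symm (h12 1) (k01 2).symm (by simp [hv]) h
  · exact hf.not_alternates (k12 0).symm (h01 1) (h12 1) (k12 2) (by simp [hv]) h
  · exact hf.not_alternates (k01 0) (h01 1) (k12 1) (h12 2) (by simp [hv]) h
  · exact hf.not_alternates (h12 0).symm (k01 1) (k12 1) (h12 2) (by simp [hv]) h
  · exact hf.not_alternates (h12 0) (k01 2) (k12 2) (h12 2).symm (by simp [hv]) h
  · exact hf.not_alternates (k01 1) (k12 1) (h12 2) (k12 2).symm (by simp [hv]) h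
  · exact hf.not_alternates (k12 0) (h01 2) (h12 2) (k12 2).symm (by simp [hv]) h

/-- The arcs of the digraph on four states whose closed walks are concatenations of the cycles
`0 → 1 → 2 → 0` and `0 → 1 → 2 → 3 → 0`. -/
def StateArc (a b : Fin 4) : Prop := (b.val = a.val + 1) ∨ (b = 0 ∧ 2 ≤ a.val)

instance (a b : Fin 4) : Decidable (StateArc a b) := inferInstanceAs (Decidable (_ ∨ _))

theorem exists_closed_stateArc_walk {n : ℕ} (hn : 3 ≤ n) (hn5 : n ≠ 5) [NeZero n] :
    ∃ x : Fin n → Fin 4, ∀ i, StateArc (x i) (x (i + 1)) := by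
  -- Take `4 * (n % 3)` vertices in cycles of length four, the others in cycles of length three.
  refine ⟨fun i => if h : i.val < 4 * (n % 3) then ⟨i.val % 4, by omega⟩
    else ⟨(i.val - 4 * (n % 3)) % 3, by omega⟩, fun i => ?_⟩
  have hi := i.isLt
  have hsucc : (i + 1).val = if i.val + 1 = n then 0 else i.val + 1 := by
    rw [Fin.val_add, Fin.val_one', Nat.mod_eq_of_lt (by omega : 1 < n)]
    split_ifs with h
    · simp [h]
    · exact Nat.mod_eq_of_lt (by omega)
  have hr : n % 3 < 3 := Nat.mod_lt _ (by omega)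
  simp only [StateArc, Fin.ext_iff, Fin.val_zero, apply_dite Fin.val, hsucc]
  split_ifs <;> omega

/-- The color assigned to a pair of states. -/
def stateColor : Fin 4 → Fin 4 → Fin 4 :=
  ![![0, 1, 3, 2], ![2, 3, 1, 0], ![3, 2, 0, 1], ![1, 0, 2, 3]]

/-- The four unit steps of the square grid. -/
def gridStep : Fin 4 → ℤ × ℤ := ![(1, 0), (-1, 0), (0, 1), (0, -1)]

/-- The function on `{-2, …, 2}` with the given five values. -/
def windowFun (a b c d e : Fin 4) (k : ℤ) : Fin 4 :=
  if k = -2 then a else if k = -1 then b else if k = 0 then c else if k = 1 then d else e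

theorem windowFun_eq (x : ℤ → Fin 4) {k : ℤ} (h : -2 ≤ k) (h' : k ≤ 2) :
    windowFun (x (-2)) (x (-1)) (x 0) (x 1) (x 2) k = x k := by
  interval_cases k <;> rfl

/-- The steps `s, t` and `u, w` lead from the origin along the two halves of a path on five
vertices that does not close up. -/
def IsPathSteps (s t u w : Fin 4) : Prop :=
  gridStep s + gridStep t ≠ 0 ∧ gridStep s ≠ gridStep u ∧ gridStep u + gridStep w ≠ 0 ∧
    gridStep s + gridStep t ≠ gridStep u + gridStep w

instance (s t u w : Fin 4) : Decidable (IsPathSteps s t u w) := inferInstanceAs (Decidable (_ ∧ _))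

/-- The coloring `F` of the grid alternates along the path with the given steps. -/
def AlternatesAlong (F : ℤ × ℤ → Fin 4) (s t u w : Fin 4) : Prop :=
  Alternates (F (gridStep s + gridStep t)) (F (gridStep s)) (F 0) (F (gridStep u))
    (F (gridStep u + gridStep w))

instance (F : ℤ × ℤ → Fin 4) (s t u w : Fin 4) : Decidable (AlternatesAlong F s t u w) :=
  inferInstanceAs (Decidable (Alternates _ _ _ _ _))

theorem stateColor_windowFun_not_alternatesAlong :
    ∀ a b, StateArc a b → ∀ c, StateArc b c → ∀ d, StateArc c d → ∀ e, StateArc d e →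
    ∀ a' b', StateArc a' b' → ∀ c', StateArc b' c' → ∀ d', StateArc c' d' → ∀ e', StateArc d' e' →
    ∀ s t u w : Fin 4, IsPathSteps s t u w →
    ¬ AlternatesAlong
      (fun z => stateColor (windowFun a b c d e z.1) (windowFun a' b' c' d' e' z.2)) s t u w := by
  decide +kernel

theorem gridStep_mem_window : ∀ s t : Fin 4,
    ((-2 ≤ (gridStep s).1 ∧ (gridStep s).1 ≤ 2) ∧ -2 ≤ (gridStep s).2 ∧ (gridStep s).2 ≤ 2) ∧
    (-2 ≤ (gridStep s + gridStep t).1 ∧ (gridStep s + gridStep t).1 ≤ 2) ∧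
    -2 ≤ (gridStep s + gridStep t).2 ∧ (gridStep s + gridStep t).2 ≤ 2 := by
  decide

theorem stateColor_not_alternatesAlong {x y : ℤ → Fin 4} (hx : ∀ k, StateArc (x k) (x (k + 1)))
    (hy : ∀ k, StateArc (y k) (y (k + 1))) {s t u w : Fin 4} (h : IsPathSteps s t u w) :
    ¬ AlternatesAlong (fun z => stateColor (x z.1) (y z.2)) s t u w := by
  have key := stateColor_windowFun_not_alternatesAlong
    (x (-2)) (x (-1)) (hx (-2)) (x 0) (hx (-1)) (x 1) (hx 0) (x 2) (hx 1)
    (y (-2)) (y (-1)) (hy (-2)) (y 0) (hy (-1)) (y 1) (hy 0) (y 2) (hy 1) s t u w h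
  obtain ⟨⟨hs, hs'⟩, hst, hst'⟩ := gridStep_mem_window s t
  obtain ⟨⟨hu, hu'⟩, huw, huw'⟩ := gridStep_mem_window u w
  have h0 : (-2 : ℤ) ≤ (0 : ℤ × ℤ).1 ∧ (0 : ℤ × ℤ).1 ≤ 2 := by decide
  have h0' : (-2 : ℤ) ≤ (0 : ℤ × ℤ).2 ∧ (0 : ℤ × ℤ).2 ≤ 2 := by decide
  unfold AlternatesAlong at key ⊢
  beta_reduce at key ⊢
  rwa [windowFun_eq x hs.1 hs.2, windowFun_eq y hs'.1 hs'.2, windowFun_eq x hst.1 hst.2,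
    windowFun_eq y hst'.1 hst'.2, windowFun_eq x hu.1 hu.2, windowFun_eq y hu'.1 hu'.2,
    windowFun_eq x huw.1 huw.2, windowFun_eq y huw'.1 huw'.2, windowFun_eq x h0.1 h0.2,
    windowFun_eq y h0'.1 h0'.2] at key

theorem stateColor_ne_of_stateArc : ∀ a b, StateArc a b → ∀ c,
    stateColor a c ≠ stateColor b c ∧ stateColor c a ≠ stateColor c b := by
  decide +kernel

/-- Translation of a vertex of the torus by an integer vector. -/
def torusShift {p q : ℕ} [NeZero p] [NeZero q] (v : Fin p × Fin q) (z : ℤ × ℤ) : Fin p × Fin q :=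
  (v.1 + z.1 • 1, v.2 + z.2 • 1)

section Torus

variable {p q : ℕ} [NeZero p] [NeZero q]

theorem torusShift_zero (v : Fin p × Fin q) : torusShift v 0 = v := by
  simp [torusShift]

theorem torusShift_add (v : Fin p × Fin q) (z z' : ℤ × ℤ) :
    torusShift v (z + z') = torusShift (torusShift v z) z' := by
  simp [torusShift, add_zsmul, add_assoc]

theorem cycleGraph_adj_imp {i j : Fin p} (h : (cycleGraph p).Adj i j) :
    j = i + 1 ∨ i = j + 1 := by
  obtain _ | _ | p := p
  · exact i.elim0
  · exact absurd (Fin.ext (by omega)) h.ne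
  · rw [cycleGraph_adj] at h
    rcases h with h | h
    · exact .inr (by rw [← h]; abel)
    · exact .inl (by rw [← h]; abel)

theorem exists_eq_torusShift_of_adj {v w : Fin p × Fin q}
    (h : ((cycleGraph p).boxProd (cycleGraph q)).Adj v w) :
    ∃ s, w = torusShift v (gridStep s) := by
  obtain ⟨a, b⟩ := v
  obtain ⟨c, d⟩ := w
  rcases boxProd_adj.1 h with ⟨h, h'⟩ | ⟨h, h'⟩ <;> rcases cycleGraph_adj_imp h with h | h <;>
    dsimp only at h h' <;> subst h h'
  · exact ⟨0, by simp [torusShift, gridStep]⟩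
  · exact ⟨1, by simp [torusShift, gridStep]⟩
  · exact ⟨2, by simp [torusShift, gridStep]⟩
  · exact ⟨3, by simp [torusShift, gridStep]⟩

theorem isPkColoring_five_stateColor {x : Fin p → Fin 4} {y : Fin q → Fin 4}
    (hx : ∀ i, StateArc (x i) (x (i + 1))) (hy : ∀ j, StateArc (y j) (y (j + 1))) :
    IsPkColoring ((cycleGraph p).boxProd (cycleGraph q)) 5
      (fun v => stateColor (x v.1) (y v.2)) := by
  refine isPkColoring_five_of_not_alternates ?_ ?_
  · rintro ⟨a, b⟩ ⟨c, d⟩ h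
    rcases boxProd_adj.1 h with ⟨h, h'⟩ | ⟨h, h'⟩ <;> rcases cycleGraph_adj_imp h with h | h <;>
      dsimp only at h h' ⊢ <;> subst h h'
    · exact (stateColor_ne_of_stateArc _ _ (hx _) _).1
    · exact (stateColor_ne_of_stateArc _ _ (hx _) _).1.symm
    · exact (stateColor_ne_of_stateArc _ _ (hy _) _).2
    · exact (stateColor_ne_of_stateArc _ _ (hy _) _).2.symm
  · intro a b c d e hab hbc hcd hde hac hbd hce hae
    obtain ⟨s, rfl⟩ := exists_eq_torusShift_of_adj hbc.symm
    obtain ⟨t, rfl⟩ := exists_eq_torusShift_of_adj hab.symm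
    obtain ⟨u, rfl⟩ := exists_eq_torusShift_of_adj hcd
    obtain ⟨w, rfl⟩ := exists_eq_torusShift_of_adj hde
    simp only [← torusShift_add] at hac hce hae ⊢
    have h : IsPathSteps s t u w :=
      ⟨fun h => hac (by rw [h, torusShift_zero]), fun h => hbd (by rw [h]),
        fun h => hce (by rw [h, torusShift_zero]), fun h => hae (by rw [h])⟩
    have key := stateColor_not_alternatesAlong (x := fun k => x (c.1 + k • 1))
      (y := fun k => y (c.2 + k • 1))
      (fun k => by simpa [add_zsmul, add_assoc] using hx (c.1 + k • 1))
      (fun k => by simpa [add_zsmul, add_assoc] using hy (c.2 + k • 1)) h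
    simpa [AlternatesAlong, torusShift] using key

end Torus

theorem s5_cycle_boxProd_cycle (p q : ℕ) (hp : 3 ≤ p) (hq : 3 ≤ q)
    (hp5 : p ≠ 5) (hq5 : q ≠ 5) :
    pkChrom ((cycleGraph p).boxProd (cycleGraph q)) 5 = 4 := by
  have : NeZero p := ⟨by omega⟩
  have : NeZero q := ⟨by omega⟩
  obtain ⟨x, hx⟩ := exists_closed_stateArc_walk hp hp5
  obtain ⟨y, hy⟩ := exists_closed_stateArc_walk hq hq5
  have hmem : 4 ∈ {n : ℕ | ∃ f : Fin p × Fin q → Fin n,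
      IsPkColoring ((cycleGraph p).boxProd (cycleGraph q)) 5 f} :=
    ⟨_, isPkColoring_five_stateColor hx hy⟩
  refine le_antisymm (Nat.sInf_le hmem) (le_csInf ⟨_, hmem⟩ ?_)
  rintro n ⟨f, hf⟩
  exact four_le_of_isPkColoring_five hp hq hf
end
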